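/- Let G be a hyperbolic group with finite generating set Σ. Then the language Λ(G) of geodesic words over Σ, i.e., the set of words w ∈ Σ* with |w| = |w̄|, is a regular language. -/

import Mathlib

section Preamble

variable {G : Type*} [Group G]

/-- The word length of `g : G` with respect to the generating set `S`. -/
noncomputable def wordLength (S : Set G) (g : G) : ℕ :=
  sInf {n | ∃ w : List G, (∀ x ∈ w, x ∈ S) ∧ w.length = n ∧ w.prod = g}

/-- The word metric `d(x, y) = |x⁻¹ y|` on the Cayley graph of `G`. -/
noncomputable def wordDist (S : Set G) (x y : G) : ℕ := wordLength S (x⁻¹ * y)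

/-- `S` is a finite generating set of `G` closed under inversion. -/
def IsGenSet (S : Set G) : Prop :=
  S.Finite ∧ (∀ x ∈ S, x⁻¹ ∈ S) ∧ Subgroup.closure S = ⊤

/-- `γ`, restricted to `{0, …, n}`, is a geodesic segment in the Cayley graph. -/
def IsGeodesicSegment (S : Set G) (γ : ℕ → G) (n : ℕ) : Prop :=
  ∀ i j, i ≤ n → j ≤ n → wordDist S (γ i) (γ j) = Nat.dist i j

/-- `r : ℕ → G` is a geodesic ray in the Cayley graph. -/
def IsGeodesicRay (S : Set G) (r : ℕ → G) : Prop :=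
  ∀ i j, wordDist S (r i) (r j) = Nat.dist i j

/-- Every geodesic triangle in the Cayley graph of `G` is `δ`-thin: each side lies in
the `δ`-neighborhood of the union of the other two sides. -/
def IsDeltaHyperbolic (S : Set G) (δ : ℕ) : Prop :=
  ∀ (γ₁ γ₂ γ₃ : ℕ → G) (n₁ n₂ n₃ : ℕ),
    IsGeodesicSegment S γ₁ n₁ → IsGeodesicSegment S γ₂ n₂ → IsGeodesicSegment S γ₃ n₃ →
    γ₁ 0 = γ₃ 0 → γ₁ n₁ = γ₂ 0 → γ₂ n₂ = γ₃ n₃ →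
    ∀ k ≤ n₃, ∃ i, (i ≤ n₁ ∧ wordDist S (γ₃ k) (γ₁ i) ≤ δ) ∨
      (i ≤ n₂ ∧ wordDist S (γ₃ k) (γ₂ i) ≤ δ)

/-- `G` is hyperbolic with respect to `S`: some `δ` makes all triangles `δ`-thin. -/
def IsHyperbolic (S : Set G) : Prop := ∃ δ : ℕ, IsDeltaHyperbolic S δ

/-- `H` is a `K`-quasiconvex subgroup: every geodesic between points of `H`
lies in the `K`-neighborhood of `H`. -/
def IsQuasiconvex (S : Set G) (H : Subgroup G) (K : ℕ) : Prop :=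
  ∀ (γ : ℕ → G) (n : ℕ), IsGeodesicSegment S γ n → γ 0 ∈ H → γ n ∈ H →
    ∀ i ≤ n, ∃ h ∈ H, wordDist S (γ i) h ≤ K

/-- Property (*): there is a set-theoretic section `s : G/H → G` of the coset
projection whose image is a net in `G` for the word metric of `S`. -/
def SatisfiesStar (S : Set G) (H : Subgroup G) : Prop :=
  ∃ s : G ⧸ H → G, (∀ q : G ⧸ H, (QuotientGroup.mk (s q) : G ⧸ H) = q) ∧
    ∃ C : ℕ, ∀ g : G, ∃ q : G ⧸ H, wordDist S g (s q) ≤ C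

/-- A hyperbolic group is elementary if it is finite or has an infinite cyclic
subgroup of finite index. -/
def IsElementary (G : Type*) [Group G] : Prop :=
  Finite G ∨ ∃ H : Subgroup G, IsCyclic H ∧ Infinite H ∧ H.index ≠ 0

end Preamble

section Languages

variable {G : Type*} [Group G]

/-- Evaluation of a word over the alphabet `↥S` as an element of `G`. -/
def evalWord (S : Finset G) (w : List {x : G // x ∈ S}) : G :=
  (w.map Subtype.val).prod

/-- The language `Λ` of geodesic words over `Σ`: words whose length equals the
word length of the group element they represent. -/
def geodesicLanguage (S : Finset G) : Language {x : G // x ∈ S} :=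
  {w | w.length = wordLength (↑S : Set G) (evalWord S w)}

end Languages

section Helpers

variable {G : Type*} [Group G]

lemma wl_le (S : Set G) (w : List G) (hw : ∀ x ∈ w, x ∈ S) :
    wordLength S w.prod ≤ w.length :=
  Nat.sInf_le ⟨w, hw, rfl, rfl⟩

lemma wl_exists {S : Set G} (hS : IsGenSet S) (g : G) :
    ∃ w : List G, (∀ x ∈ w, x ∈ S) ∧ w.length = wordLength S g ∧ w.prod = g := by
  have hne : {n | ∃ w : List G, (∀ x ∈ w, x ∈ S) ∧ w.length = n ∧ w.prod = g}.Nonempty := by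
    have hg : g ∈ Subgroup.closure S := by rw [hS.2.2]; trivial
    rw [← Subgroup.mem_toSubmonoid, Subgroup.closure_toSubmonoid] at hg
    obtain ⟨l, hl, hp⟩ := Submonoid.exists_list_of_mem_closure hg
    refine ⟨l.length, l, fun x hx => ?_, rfl, hp⟩
    rcases hl x hx with h | h
    · exact h
    · simpa using hS.2.1 _ h
  exact Nat.sInf_mem hne

lemma wl_mul {S : Set G} (hS : IsGenSet S) (g h : G) :
    wordLength S (g * h) ≤ wordLength S g + wordLength S h := by
  obtain ⟨w, hw, hl, hp⟩ := wl_exists hS g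
  obtain ⟨v, hv, hl', hp'⟩ := wl_exists hS h
  have := wl_le S (w ++ v) (by
    intro x hx
    rcases List.mem_append.1 hx with h | h
    · exact hw x h
    · exact hv x h)
  simpa [hp, hp', hl, hl'] using this

lemma wl_inv_le {S : Set G} (hS : IsGenSet S) (g : G) :
    wordLength S g⁻¹ ≤ wordLength S g := by
  obtain ⟨w, hw, hl, hp⟩ := wl_exists hS g
  have := wl_le S (w.map (·⁻¹)).reverse (by
    intro x hx
    simp only [List.mem_reverse, List.mem_map] at hx
    obtain ⟨y, hy, rfl⟩ := hx
    exact hS.2.1 _ (hw y hy))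
  rw [← List.prod_inv_reverse, hp] at this
  simpa [hl] using this

lemma wl_inv {S : Set G} (hS : IsGenSet S) (g : G) :
    wordLength S g⁻¹ = wordLength S g :=
  le_antisymm (wl_inv_le hS g) (by simpa using wl_inv_le hS g⁻¹)

lemma wl_one (S : Set G) : wordLength S (1 : G) = 0 := by
  simpa using wl_le S [] (by simp)

lemma wd_comm {S : Set G} (hS : IsGenSet S) (x y : G) : wordDist S x y = wordDist S y x := by
  unfold wordDist
  rw [← wl_inv hS]; simp

lemma wd_tri {S : Set G} (hS : IsGenSet S) (x y z : G) :
    wordDist S x z ≤ wordDist S x y + wordDist S y z := by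
  unfold wordDist
  simpa [mul_assoc] using wl_mul hS (x⁻¹ * y) (y⁻¹ * z)

lemma wd_one_left (S : Set G) (x : G) : wordDist S 1 x = wordLength S x := by
  simp [wordDist]

/-- A geodesic word traces out a geodesic segment. -/
lemma geod_of_word {S : Set G} (hS : IsGenSet S) (x : G) (w : List G) (hw : ∀ y ∈ w, y ∈ S)
    (hl : w.length = wordLength S w.prod) :
    IsGeodesicSegment S (fun i => x * (w.take i).prod) w.length := by
  have key : ∀ i j, i ≤ j → j ≤ w.length →
      wordDist S (x * (w.take i).prod) (x * (w.take j).prod) = j - i := by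
    intro i j hij hj
    have e1 : w.take j = w.take i ++ (w.drop i).take (j - i) := by
      rw [← List.take_add]; congr 1; omega
    have e0 : wordDist S (x * (w.take i).prod) (x * (w.take j).prod)
        = wordLength S ((w.drop i).take (j - i)).prod := by
      unfold wordDist
      rw [e1, List.prod_append]
      congr 1; group
    rw [e0]
    have h1 := wl_le S ((w.drop i).take (j - i))
      (fun y hy => hw y (List.mem_of_mem_drop (List.mem_of_mem_take hy)))
    have h2 := wl_le S (w.take i) (fun y hy => hw y (List.mem_of_mem_take hy))
    have h3 := wl_le S (w.drop j) (fun y hy => hw y (List.mem_of_mem_drop hy))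
    have e2 : w.prod = (w.take i).prod * ((w.drop i).take (j - i)).prod * (w.drop j).prod := by
      rw [← List.prod_append, ← e1, ← List.prod_append, List.take_append_drop]
    have h4 := wl_mul hS ((w.take i).prod * ((w.drop i).take (j - i)).prod) (w.drop j).prod
    have h5 := wl_mul hS (w.take i).prod ((w.drop i).take (j - i)).prod
    rw [← e2, ← hl] at h4
    simp only [List.length_take, List.length_drop] at h1 h2 h3
    omega
  intro i j hi hj
  rcases le_total i j with h | h
  · rw [key i j h hj, Nat.dist_eq_sub_of_le h]
  · rw [wd_comm hS, key j i h hi, Nat.dist_comm, Nat.dist_eq_sub_of_le h]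

lemma geod_exists {S : Set G} (hS : IsGenSet S) (x y : G) :
    ∃ γ : ℕ → G, IsGeodesicSegment S γ (wordDist S x y) ∧ γ 0 = x ∧ γ (wordDist S x y) = y := by
  obtain ⟨w, hw, hl, hp⟩ := wl_exists hS (x⁻¹ * y)
  refine ⟨fun i => x * (w.take i).prod, ?_, by simp, ?_⟩
  · have := geod_of_word hS x w hw (by rw [hl, hp])
    rwa [hl] at this
  · change x * (w.take (wordLength S (x⁻¹ * y))).prod = y
    rw [← hl, List.take_length, hp]; group

lemma ball_finite {S : Set G} (hS : IsGenSet S) (N : ℕ) : {h : G | wordLength S h ≤ N}.Finite := by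
  have := hS.1.to_subtype
  have hf : {l : List S | l.length ≤ N}.Finite := List.finite_length_le S N
  refine (hf.image (fun l => (l.map Subtype.val).prod)).subset ?_
  intro h hh
  obtain ⟨w, hw, hl, hp⟩ := wl_exists hS h
  refine ⟨w.attachWith _ hw, ?_, ?_⟩
  · simp only [Set.mem_ofPred_eq, List.length_attachWith]
    exact hl.le.trans hh
  · simp [hp]

/-- Elements of the ball of radius `N` that decrease the length of `g` by one. -/
def descents (S : Set G) (N : ℕ) (g : G) : Set G :=
  {h | wordLength S h ≤ N ∧ wordLength S (g * h) + 1 = wordLength S g}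

/-- Geometric key step: if `g` lies on a geodesic `1 → g u`, and `g u a` is not further away,
there is a short descent of `g` towards `g u a`. -/
lemma descent_exists {S : Set G} (hS : IsGenSet S) {δ : ℕ} (hδ : IsDeltaHyperbolic S δ)
    (g : G) (hg : wordLength S g ≠ 0) (u : List G) (hu : ∀ x ∈ u, x ∈ S)
    (hgu : wordLength S (g * u.prod) = wordLength S g + u.length)
    (a : G) (ha : a ∈ S) (hgh : wordLength S (g * (u.prod * a)) ≤ wordLength S g + u.length) :
    ∃ k ∈ descents S (2 * δ + 3) g, wordLength S (k⁻¹ * (u.prod * a)) ≤ u.length + 1 := by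
  obtain ⟨W, hW, hWl, hWp⟩ := wl_exists hS g
  have hWu : ∀ y ∈ W ++ u, y ∈ S := by
    intro x hx
    rcases List.mem_append.1 hx with h | h
    · exact hW x h
    · exact hu x h
  have g3 := geod_of_word hS 1 (W ++ u) hWu (by simp [hWp, hgu, hWl])
  obtain ⟨γ₁, g1, s1, t1⟩ := geod_exists hS 1 (g * (u.prod * a))
  obtain ⟨γ₂, g2, s2, t2⟩ := geod_exists hS (g * (u.prod * a)) (g * u.prod)
  have hd2 : wordDist S (g * (u.prod * a)) (g * u.prod) ≤ 1 := by
    have : (g * (u.prod * a))⁻¹ * (g * u.prod) = a⁻¹ := by group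
    rw [wordDist, this, wl_inv hS]
    simpa using wl_le S [a] (by simpa using ha)
  have hm1 := wd_tri hS 1 (g * (u.prod * a)) (g * u.prod)
  rw [wd_one_left, wd_one_left, hgu] at hm1
  rw [wd_one_left] at g1 t1
  set m := wordLength S (g * (u.prod * a)) with hm
  set n₂ := wordDist S (g * (u.prod * a)) (g * u.prod) with hn2
  obtain ⟨i, hi⟩ := hδ γ₁ γ₂ _ m n₂ _ g1 g2 g3 (by simp [s1]) (by rw [t1, s2])
    (by rw [t2, List.take_length]; simp [hWp]) W.length (by simp)
  have e3 : (1 : G) * ((W ++ u).take W.length).prod = g := by simp [hWp]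
  simp only [e3] at hi
  have hi' : ∃ i ≤ m, wordDist S g (γ₁ i) ≤ δ + 1 := by
    rcases hi with ⟨h, h'⟩ | ⟨h, h'⟩
    · exact ⟨i, h, by omega⟩
    · refine ⟨m, le_rfl, ?_⟩
      have q := wd_tri hS g (γ₂ i) (γ₁ m)
      have q2 := g2 i 0 h (Nat.zero_le _)
      rw [s2] at q2
      rw [t1] at q ⊢
      simp only [Nat.dist] at q2
      omega
  clear hi
  obtain ⟨i, him, hi⟩ := hi'
  have r0 : wordLength S (γ₁ i) = i := by
    have := g1 0 i (Nat.zero_le _) him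
    rw [s1, wd_one_left] at this
    simpa [Nat.dist] using this
  have r1 := wd_tri hS 1 g (γ₁ i)
  have r2 := wd_tri hS 1 (γ₁ i) g
  rw [wd_comm hS (γ₁ i) g] at r2
  simp only [wd_one_left, r0] at r1 r2
  set p := wordLength S g - 1 with hp
  have hpm : p ≤ m := by omega
  have r3 := g1 i p him hpm
  have r4 := g1 p m hpm le_rfl
  have r5 := g1 0 p (Nat.zero_le _) hpm
  rw [s1, wd_one_left] at r5
  have r6 := wd_tri hS g (γ₁ i) (γ₁ p)
  simp only [Nat.dist] at r3 r4 r5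
  refine ⟨g⁻¹ * γ₁ p, ⟨?_, ?_⟩, ?_⟩
  · change wordDist S g (γ₁ p) ≤ _
    omega
  · rw [mul_inv_cancel_left]
    omega
  · have : (g⁻¹ * γ₁ p)⁻¹ * (u.prod * a) = (γ₁ p)⁻¹ * (g * (u.prod * a)) := by group
    rw [this, ← t1]
    change wordDist S (γ₁ p) (γ₁ m) ≤ _
    omega

/-- The descents determine the cone type. -/
lemma cone_of_descents {S : Set G} (hS : IsGenSet S) {δ : ℕ} (hδ : IsDeltaHyperbolic S δ)
    (g g' : G) (h : descents S (2 * δ + 3) g = descents S (2 * δ + 3) g')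
    (v : List G) (hv : ∀ x ∈ v, x ∈ S)
    (hgv : wordLength S (g * v.prod) = wordLength S g + v.length) :
    wordLength S (g' * v.prod) = wordLength S g' + v.length := by
  induction v using List.reverseRecOn with
  | nil => simp
  | append_singleton u a ih =>
    have hu : ∀ x ∈ u, x ∈ S := fun x hx => hv x (by simp [hx])
    have ha : a ∈ S := hv a (by simp)
    have la : wordLength S a ≤ 1 := by simpa using wl_le S [a] (by simpa using ha)
    have lu := wl_le S u hu
    simp only [List.prod_append, List.prod_singleton, List.length_append,
      List.length_singleton] at hgv ⊢
    have q1 := wl_mul hS (g * u.prod) a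
    have q2 := wl_mul hS g u.prod
    rw [mul_assoc] at q1
    have ihu := ih hu (by omega)
    have q3 := wl_mul hS (g' * u.prod) a
    rw [mul_assoc] at q3
    by_contra hne
    have q6 := wl_mul hS g (u.prod * a)
    by_cases hg' : wordLength S g' = 0
    · obtain ⟨w, -, hl, hp⟩ := wl_exists hS g'
      have : w = [] := by rw [← List.length_eq_zero_iff, hl, hg']
      subst this
      simp only [List.prod_nil] at hp
      rw [← hp, wl_one, one_mul] at hne
      have q5 := wl_mul hS u.prod a
      omega
    · obtain ⟨k, hk, hkl⟩ := descent_exists hS hδ g' hg' u hu ihu a ha (by omega)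
      rw [← h] at hk
      have q4 := wl_mul hS (g * k) (k⁻¹ * (u.prod * a))
      have e : g * k * (k⁻¹ * (u.prod * a)) = g * (u.prod * a) := by group
      rw [e] at q4
      have := hk.2
      omega

lemma evalWord_append (S : Finset G) (w v : List {x : G // x ∈ S}) :
    evalWord S (w ++ v) = evalWord S w * (v.map Subtype.val).prod := by
  simp [evalWord]

lemma evalWord_le (S : Finset G) (w : List {x : G // x ∈ S}) :
    wordLength (↑S : Set G) (evalWord S w) ≤ w.length := by
  simpa [evalWord] using wl_le (↑S : Set G) (w.map Subtype.val) (by simp +contextual)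

lemma geod_append_iff (S : Finset G) (hS : IsGenSet (↑S : Set G)) (w v : List {x : G // x ∈ S}) :
    w ++ v ∈ geodesicLanguage S ↔ w ∈ geodesicLanguage S ∧
      wordLength (↑S : Set G) (evalWord S w * (v.map Subtype.val).prod) =
        wordLength (↑S : Set G) (evalWord S w) + (v.map Subtype.val).length := by
  change (w ++ v).length = wordLength (↑S : Set G) (evalWord S (w ++ v)) ↔
    w.length = wordLength (↑S : Set G) (evalWord S w) ∧ _
  rw [evalWord_append, List.length_append, List.length_map]
  have h1 := evalWord_le S w
  have h2 := evalWord_le S v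
  have h3 := wl_mul hS (evalWord S w) (evalWord S v)
  change _ + _ = wordLength (↑S : Set G) (evalWord S w * evalWord S v) ↔
    _ ∧ wordLength (↑S : Set G) (evalWord S w * evalWord S v) = _
  omega

end Helpers

/-- For a hyperbolic group, the language of geodesic words is regular. -/
theorem statement_9 {G : Type*} [Group G] (S : Finset G) (hGen : IsGenSet (↑S : Set G))
    (hHyp : IsHyperbolic (↑S : Set G)) :
    (geodesicLanguage S).IsRegular := by
  obtain ⟨δ, hδ⟩ := hHyp
  rw [Language.isRegular_iff_finite_range_leftQuotient]
  let f : List {x : G // x ∈ S} → Prop × Set G := fun w =>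
    (w ∈ geodesicLanguage S, descents (↑S : Set G) (2 * δ + 3) (evalWord S w))
  have hf : (Set.range f).Finite := by
    refine (Set.Finite.prod (Set.finite_univ (α := Prop))
      (ball_finite hGen (2 * δ + 3)).finite_subsets).subset ?_
    rintro _ ⟨w, rfl⟩
    exact ⟨trivial, fun h hh => hh.1⟩
  have hfac : Function.FactorsThrough (geodesicLanguage S).leftQuotient f := by
    intro w w' h
    have h1 : (w ∈ geodesicLanguage S) = (w' ∈ geodesicLanguage S) := congrArg Prod.fst h
    have h2 : descents (↑S : Set G) (2 * δ + 3) (evalWord S w) =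
      descents (↑S : Set G) (2 * δ + 3) (evalWord S w') := congrArg Prod.snd h
    ext v
    rw [Language.mem_leftQuotient, Language.mem_leftQuotient, geod_append_iff S hGen,
      geod_append_iff S hGen, h1]
    have hv : ∀ x ∈ v.map Subtype.val, x ∈ (↑S : Set G) := by simp +contextual
    exact and_congr_right fun _ =>
      ⟨cone_of_descents hGen hδ _ _ h2 _ hv, cone_of_descents hGen hδ _ _ h2.symm _ hv⟩
  obtain ⟨e, he⟩ := (Function.factorsThrough_iff _).1 hfac
  rw [he, Set.range_comp]
  exact hf.image e
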